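/- arXiv:2403.08446 — 2 statements merged into one kernel-verified Lean document; each statement's English description precedes it below -/
import Mathlib

section
/- Let a and x be coprime integers with 1 ≤ a < x. Let L and L′ be nonempty lists of integers, each entry ≥ 2, such that r(L) = x and s(L) = x − a (so L represents x/(x−a)), and r(L′) = a + x and s(L′) = x (so L′ represents a/x + 1). Then 𝓢(L′) = 𝓡(L) and 𝓡(L′) − 𝓢(L′) = q·(𝓡(L) − 𝓢(L)) in ℤ[q]. (Under the convention 𝓢_{a/x} := 𝓢_{a/x+1} and 𝓡_{a/x} := q^{−1}(𝓡_{a/x+1} − 𝓢_{a/x+1}), this says 𝓡_{a/x} = 𝓡_{x/(x−a)} − 𝓢_{x/(x−a)} and 𝓢_{a/x} = 𝓡_{x/(x−a)}.) -/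
open Polynomial

/-- The `q`-deformation `[n]_q = 1 + q + ⋯ + q^{n-1}` of a nonnegative integer. -/
noncomputable def qNat (n : ℕ) : Polynomial ℤ := (Finset.range n).sum fun i => X ^ i

/-- The matrix `M_q⁻(c) = (([c]_q, -q^{c-1}), (1, 0))` over `ℤ[q]`. -/
noncomputable def MqNeg (c : ℕ) : Matrix (Fin 2) (Fin 2) (Polynomial ℤ) :=
  !![qNat c, -(X ^ (c - 1)); 1, 0]

/-- `𝓡(c)`: the (0,0) entry of `M_q⁻(c₁)⋯M_q⁻(c_l)`. -/
noncomputable def Rpoly (L : List ℕ) : Polynomial ℤ := ((L.map MqNeg).prod) 0 0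

/-- `𝓢(c)`: the (1,0) entry of `M_q⁻(c₁)⋯M_q⁻(c_l)`. -/
noncomputable def Spoly (L : List ℕ) : Polynomial ℤ := ((L.map MqNeg).prod) 1 0

/-- `r(c) = 𝓡(c)(1)`. -/
noncomputable def rNum (L : List ℕ) : ℤ := (Rpoly L).eval 1

/-- `s(c) = 𝓢(c)(1)`. -/
noncomputable def sNum (L : List ℕ) : ℤ := (Spoly L).eval 1

theorem Rpoly_cons (c : ℕ) (L : List ℕ) :
    Rpoly (c :: L) = qNat c * Rpoly L - X ^ (c - 1) * Spoly L := by
  simp [Rpoly, Spoly, MqNeg, Matrix.mul_apply, Fin.sum_univ_two, sub_eq_add_neg]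

theorem Spoly_cons (c : ℕ) (L : List ℕ) : Spoly (c :: L) = Rpoly L := by
  simp [Rpoly, Spoly, MqNeg, Matrix.mul_apply, Fin.sum_univ_two]

theorem rNum_cons (c : ℕ) (L : List ℕ) : rNum (c :: L) = c * rNum L - sNum L := by
  simp [rNum, sNum, Rpoly_cons, qNat, eval_finsetSum]

theorem sNum_cons (c : ℕ) (L : List ℕ) : sNum (c :: L) = rNum L := by
  simp [rNum, sNum, Spoly_cons]

theorem rNum_nil : rNum [] = 1 := by simp [rNum, Rpoly]

theorem sNum_nil : sNum [] = 0 := by simp [sNum, Spoly]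

theorem sNum_nonneg_and_lt_rNum (L : List ℕ) (hL : ∀ y ∈ L, 2 ≤ y) :
    0 ≤ sNum L ∧ sNum L < rNum L := by
  induction L with
  | nil => simp [rNum_nil, sNum_nil]
  | cons c L ih =>
    obtain ⟨hc, hL⟩ := List.forall_mem_cons.mp hL
    obtain ⟨h0, h1⟩ := ih hL
    have hc' : (2 : ℤ) ≤ c := by exact_mod_cast hc
    rw [sNum_cons, rNum_cons]
    constructor <;> nlinarith

/-- A list with entries at least `2` is determined by its numerator and denominator. -/
theorem eq_of_rNum_eq_of_sNum_eq (L L' : List ℕ) (hL : ∀ y ∈ L, 2 ≤ y) (hL' : ∀ y ∈ L', 2 ≤ y)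
    (hr : rNum L = rNum L') (hs : sNum L = sNum L') : L = L' := by
  induction L generalizing L' with
  | nil =>
    cases L' with
    | nil => rfl
    | cons d L' =>
      obtain ⟨h0, h1⟩ := sNum_nonneg_and_lt_rNum L' (List.forall_mem_cons.mp hL').2
      rw [sNum_nil, sNum_cons] at hs
      omega
  | cons c L ih =>
    obtain ⟨h0, h1⟩ := sNum_nonneg_and_lt_rNum L (List.forall_mem_cons.mp hL).2
    cases L' with
    | nil =>
      rw [sNum_nil, sNum_cons] at hs
      omega
    | cons d L' =>
      obtain ⟨h0', h1'⟩ := sNum_nonneg_and_lt_rNum L' (List.forall_mem_cons.mp hL').2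
      rw [sNum_cons, sNum_cons] at hs
      rw [rNum_cons, rNum_cons, ← hs] at hr
      rw [← hs] at h1'
      have hcd : (c : ℤ) = d := by
        apply le_antisymm <;> by_contra! h <;> nlinarith
      have hs' : sNum L = sNum L' := by
        rw [hcd] at hr
        linarith
      rw [ih L' (List.forall_mem_cons.mp hL).2 (List.forall_mem_cons.mp hL').2 hs hs',
        Nat.cast_injective hcd]

/-- If `1 ≤ a < x` are coprime, `L` represents `x/(x−a)` and `L'` represents `a/x + 1`,
then `𝓢(L') = 𝓡(L)` and `𝓡(L') − 𝓢(L') = q·(𝓡(L) − 𝓢(L))`. -/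
theorem stmt2 (a x : ℤ) (ha : 1 ≤ a) (hax : a < x) (hcop : IsCoprime a x)
    (L L' : List ℕ) (hL : L ≠ []) (hL2 : ∀ y ∈ L, 2 ≤ y)
    (hL' : L' ≠ []) (hL'2 : ∀ y ∈ L', 2 ≤ y)
    (hrL : rNum L = x) (hsL : sNum L = x - a)
    (hrL' : rNum L' = a + x) (hsL' : sNum L' = x) :
    Spoly L' = Rpoly L ∧
    Rpoly L' - Spoly L' = X * (Rpoly L - Spoly L) := by
  have h : L' = 2 :: L := by
    refine eq_of_rNum_eq_of_sNum_eq _ _ hL'2 (List.forall_mem_cons.mpr ⟨le_rfl, hL2⟩) ?_ ?_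
    · rw [rNum_cons, hrL', hrL, hsL]
      push_cast
      ring
    · rw [sNum_cons, hsL', hrL]
  subst h
  refine ⟨Spoly_cons 2 L, ?_⟩
  rw [Rpoly_cons, Spoly_cons]
  simp only [qNat, Finset.sum_range_succ, Finset.sum_range_zero]
  ring
end

section
/- Let c be a nonempty list of integers with every entry ≥ 2. Then the polynomial 𝓡(c) ∈ ℤ[q] is palindromic (i.e. 𝓡(c)^∨ = 𝓡(c)) if and only if s(c)² ≡ 1 (mod r(c)). (In the notation of q-deformed rationals: for an irreducible fraction r/s > 1, 𝓡_{r/s}(q) is palindromic if and only if s² ≡ 1 (mod r).) -/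
open Polynomial

/-- The product `M_q⁻(c₁)⋯M_q⁻(c_l)`. -/
noncomputable def MqProd (L : List ℕ) : Matrix (Fin 2) (Fin 2) ℤ[X] := (L.map MqNeg).prod

/-- `∑ (cᵢ - 1)`, the degree of `𝓡(c)` when every `cᵢ ≥ 2`. -/
def qDeg (L : List ℕ) : ℕ := (L.map fun c => c - 1).sum

theorem qDeg_cons (c : ℕ) (L : List ℕ) : qDeg (c :: L) = (c - 1) + qDeg L := by
  simp [qDeg]

theorem qDeg_reverse (L : List ℕ) : qDeg L.reverse = qDeg L := by
  simp [qDeg, List.map_reverse, List.sum_reverse]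

theorem MqProd_nil : MqProd [] = 1 := rfl

theorem MqProd_cons_zero (c : ℕ) (L : List ℕ) (j : Fin 2) :
    MqProd (c :: L) 0 j = qNat c * MqProd L 0 j - X ^ (c - 1) * MqProd L 1 j := by
  simp [MqProd, MqNeg, Matrix.mul_apply, Fin.sum_univ_two, sub_eq_add_neg]

theorem MqProd_cons_one (c : ℕ) (L : List ℕ) (j : Fin 2) :
    MqProd (c :: L) 1 j = MqProd L 0 j := by
  simp [MqProd, MqNeg, Matrix.mul_apply, Fin.sum_univ_two]

theorem MqProd_reverse_cons_zero (c : ℕ) (L : List ℕ) (i : Fin 2) :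
    MqProd (c :: L).reverse i 0 = MqProd L.reverse i 0 * qNat c + MqProd L.reverse i 1 := by
  simp [MqProd, MqNeg, Matrix.mul_apply, Fin.sum_univ_two]

theorem MqProd_reverse_cons_one (c : ℕ) (L : List ℕ) (i : Fin 2) :
    MqProd (c :: L).reverse i 1 = -(MqProd L.reverse i 0 * X ^ (c - 1)) := by
  simp [MqProd, MqNeg, Matrix.mul_apply, Fin.sum_univ_two]

theorem natDegree_qNat_le (c : ℕ) : (qNat c).natDegree ≤ c - 1 := by
  refine natDegree_sum_le_of_forall_le _ _ fun i hi => ?_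
  rw [natDegree_X_pow]
  have := Finset.mem_range.1 hi
  omega

theorem reflect_qNat (c : ℕ) : reflect (c - 1) (qNat c) = qNat c := by
  have h : ∀ s : Finset ℕ, reflect (c - 1) (s.sum fun i => (X : ℤ[X]) ^ i) =
      s.sum fun i => X ^ revAt (c - 1) i := by
    intro s
    induction s using Finset.induction_on with
    | empty => simp
    | insert a s ha ih => rw [Finset.sum_insert ha, Finset.sum_insert ha, reflect_add, ih,
        ← one_mul (X ^ a), ← C_1, reflect_C_mul_X_pow, C_1, one_mul]
  rw [qNat, h, ← Finset.sum_range_reflect]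
  refine Finset.sum_congr rfl fun i hi => ?_
  have hi' := Finset.mem_range.1 hi
  rw [revAt_le (by omega), Nat.sub_sub_self (by omega)]

theorem eval_one_qNat (c : ℕ) : (qNat c).eval 1 = c := by
  simp [qNat, eval_finsetSum]

theorem two_mul_eval_one_derivative_qNat (c : ℕ) :
    2 * (derivative (qNat c)).eval 1 = (c : ℤ) * (c - 1) := by
  induction c with
  | zero => simp [qNat]
  | succ n ih =>
    have h : qNat (n + 1) = qNat n + X ^ n := Finset.sum_range_succ _ _
    rw [h, derivative_add, eval_add, mul_add, ih]
    simp [derivative_X_pow]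
    ring

theorem natDegree_MqProd_le (L : List ℕ) :
    (MqProd L 0 0).natDegree ≤ qDeg L ∧ (MqProd L 1 0).natDegree ≤ qDeg L := by
  induction L with
  | nil => simp [MqProd_nil]
  | cons c L ih =>
    rw [MqProd_cons_zero, MqProd_cons_one, qDeg_cons]
    refine ⟨(natDegree_sub_le _ _).trans (max_le ?_ ?_), ih.1.trans (Nat.le_add_left _ _)⟩
    · exact natDegree_mul_le_of_le (natDegree_qNat_le c) ih.1
    · exact natDegree_mul_le_of_le (natDegree_X_pow_le _) ih.2

theorem MqProd_reverse_eq_reflect (L : List ℕ) :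
    MqProd L.reverse 0 0 = reflect (qDeg L) (MqProd L 0 0) ∧
      MqProd L.reverse 0 1 = -reflect (qDeg L) (MqProd L 1 0) := by
  induction L with
  | nil => simp [MqProd_nil, qDeg]
  | cons c L ih =>
    have hd := natDegree_MqProd_le L
    have hX : reflect (c - 1) ((X : ℤ[X]) ^ (c - 1)) = 1 := by
      rw [← one_mul (X ^ (c - 1)), ← C_1, reflect_C_mul_X_pow, revAt_le le_rfl]
      simp
    have hone : reflect (c - 1) (1 : ℤ[X]) = X ^ (c - 1) := by
      rw [← C_1, reflect_C]
      simp
    have hS : reflect (c - 1 + qDeg L) (MqProd L 0 0) =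
        X ^ (c - 1) * reflect (qDeg L) (MqProd L 0 0) := by
      conv_lhs => rw [← one_mul (MqProd L 0 0)]
      rw [reflect_mul _ _ (by simp) hd.1, hone]
    rw [MqProd_reverse_cons_zero, MqProd_reverse_cons_one, MqProd_cons_zero, MqProd_cons_one,
      qDeg_cons, ih.1, ih.2, reflect_sub, reflect_mul _ _ (natDegree_qNat_le c) hd.1,
      reflect_mul _ _ (natDegree_X_pow_le _) hd.2, reflect_qNat, hX, hS]
    constructor <;> ring

theorem coeff_zero_Rpoly (L : List ℕ) (hL : ∀ y ∈ L, 2 ≤ y) : (Rpoly L).coeff 0 = 1 := by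
  change (MqProd L 0 0).coeff 0 = 1
  induction L with
  | nil => simp [MqProd_nil]
  | cons c L ih =>
    have hc : 2 ≤ c := hL c (by simp)
    have hq : (qNat c).coeff 0 = 1 := by
      simp only [qNat, finsetSum_coeff, coeff_X_pow]
      simp
      omega
    rw [MqProd_cons_zero, coeff_sub, mul_coeff_zero, mul_coeff_zero, hq,
      ih fun y hy => hL y (by simp [hy]), coeff_X_pow, if_neg (by omega)]
    simp

theorem reverse_Rpoly (L : List ℕ) (hL : ∀ y ∈ L, 2 ≤ y) :
    (Rpoly L).reverse = Rpoly L.reverse := by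
  have h : Rpoly L.reverse = reflect (qDeg L) (Rpoly L) := (MqProd_reverse_eq_reflect L).1
  have hlead : (Rpoly L).coeff (qDeg L) = 1 := by
    have h0 := coeff_zero_Rpoly L.reverse (by simpa using hL)
    rwa [h, coeff_reflect, revAt_le (Nat.zero_le _), Nat.sub_zero] at h0
  have hdeg : (Rpoly L).natDegree = qDeg L :=
    le_antisymm (natDegree_MqProd_le L).1 (le_natDegree_of_ne_zero (by simp [hlead]))
  rw [Polynomial.reverse, hdeg, h]

theorem eval_one_MqProd_reverse (L : List ℕ) :
    (MqProd L.reverse 0 0).eval 1 = (MqProd L 0 0).eval 1 ∧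
      (MqProd L.reverse 0 1).eval 1 = -(MqProd L 1 0).eval 1 ∧
      (MqProd L.reverse 1 0).eval 1 = -(MqProd L 0 1).eval 1 ∧
      (MqProd L.reverse 1 1).eval 1 = (MqProd L 1 1).eval 1 := by
  induction L with
  | nil => simp [MqProd_nil]
  | cons c L ih =>
    obtain ⟨h1, h2, h3, h4⟩ := ih
    simp only [MqProd_reverse_cons_zero, MqProd_reverse_cons_one, MqProd_cons_zero,
      MqProd_cons_one, eval_add, eval_sub, eval_neg, eval_mul, eval_pow, eval_X, one_pow,
      h1, h2, h3, h4]
    refine ⟨?_, ?_, ?_, ?_⟩ <;> ring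

theorem eval_one_MqProd_det (L : List ℕ) :
    (MqProd L 0 0).eval 1 * (MqProd L 1 1).eval 1 -
      (MqProd L 0 1).eval 1 * (MqProd L 1 0).eval 1 = 1 := by
  induction L with
  | nil => simp [MqProd_nil]
  | cons c L ih =>
    simp only [MqProd_cons_zero, MqProd_cons_one, eval_sub, eval_mul, eval_pow, eval_X, one_pow]
    linear_combination ih

theorem rNum_reverse (L : List ℕ) : rNum L.reverse = rNum L := (eval_one_MqProd_reverse L).1

theorem sNum_mul_sNum_reverse_modEq (L : List ℕ) :
    sNum L * sNum L.reverse ≡ 1 [ZMOD rNum L] := by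
  have h : sNum L.reverse = -(MqProd L 0 1).eval 1 := (eval_one_MqProd_reverse L).2.2.1
  have hdet : rNum L * (MqProd L 1 1).eval 1 - (MqProd L 0 1).eval 1 * sNum L = 1 :=
    eval_one_MqProd_det L
  refine Int.modEq_iff_dvd.2 ⟨(MqProd L 1 1).eval 1, ?_⟩
  rw [h]
  linear_combination -hdet

/-- At `q = 1`, the derivative of the product `P` satisfies `2 P' = d P + T P - P T` with
`d = ∑ (cᵢ - 1)` and `T = ((0, 1), (-1, 1))`. -/
theorem two_mul_eval_one_derivative_MqProd (L : List ℕ) (hL : ∀ y ∈ L, 1 ≤ y) :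
    2 * (derivative (MqProd L 0 0)).eval 1 =
        qDeg L * (MqProd L 0 0).eval 1 + (MqProd L 1 0).eval 1 + (MqProd L 0 1).eval 1 ∧
      2 * (derivative (MqProd L 1 0)).eval 1 =
        qDeg L * (MqProd L 1 0).eval 1 - (MqProd L 0 0).eval 1 + (MqProd L 1 0).eval 1 +
          (MqProd L 1 1).eval 1 ∧
      2 * (derivative (MqProd L 0 1)).eval 1 =
        qDeg L * (MqProd L 0 1).eval 1 + (MqProd L 1 1).eval 1 - (MqProd L 0 0).eval 1 -
          (MqProd L 0 1).eval 1 ∧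
      2 * (derivative (MqProd L 1 1)).eval 1 =
        qDeg L * (MqProd L 1 1).eval 1 - (MqProd L 0 1).eval 1 - (MqProd L 1 0).eval 1 := by
  induction L with
  | nil => simp [MqProd_nil, qDeg]
  | cons c L ih =>
    obtain ⟨h1, h2, h3, h4⟩ := ih fun y hy => hL y (by simp [hy])
    have hc : 1 ≤ c := hL c (by simp)
    have hq := two_mul_eval_one_derivative_qNat c
    simp only [MqProd_cons_zero, MqProd_cons_one, qDeg_cons, derivative_sub, derivative_mul,
      derivative_X_pow, eval_add, eval_sub, eval_mul, eval_pow, eval_X, one_pow, eval_C,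
      eval_one_qNat, Nat.cast_add, Nat.cast_sub hc, Nat.cast_one, one_mul, mul_one]
    refine ⟨?_, ?_, ?_, ?_⟩
    · linear_combination (MqProd L 0 0).eval 1 * hq + c * h1 - h2
    · linear_combination h1
    · linear_combination (MqProd L 0 1).eval 1 * hq + c * h3 - h4
    · linear_combination h3

theorem two_mul_eval_one_derivative_Rpoly (L : List ℕ) (hL : ∀ y ∈ L, 1 ≤ y) :
    2 * (derivative (Rpoly L)).eval 1 = qDeg L * rNum L + sNum L - sNum L.reverse := by
  have h : sNum L.reverse = -(MqProd L 0 1).eval 1 := (eval_one_MqProd_reverse L).2.2.1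
  have h1 : 2 * (derivative (Rpoly L)).eval 1 =
    qDeg L * rNum L + sNum L + (MqProd L 0 1).eval 1 :=
      (two_mul_eval_one_derivative_MqProd L hL).1
  rw [h, h1]
  ring

/-- For an irreducible fraction `r/s > 1` (given by a negative continued-fraction list
`L`), `𝓡_{r/s}(q)` is palindromic if and only if `s² ≡ 1 (mod r)`. -/
theorem stmt11 (L : List ℕ) (hL : L ≠ []) (hL2 : ∀ y ∈ L, 2 ≤ y) :
    (Rpoly L).reverse = Rpoly L ↔ sNum L ^ 2 ≡ 1 [ZMOD rNum L] := by
  have hrev : ∀ y ∈ L.reverse, 2 ≤ y := by simpa using hL2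
  have hmul := sNum_mul_sNum_reverse_modEq L
  rw [reverse_Rpoly L hL2]
  constructor
  · intro h
    have h1 := two_mul_eval_one_derivative_Rpoly L fun y hy => one_le_two.trans (hL2 y hy)
    have h2 := two_mul_eval_one_derivative_Rpoly L.reverse
      fun y hy => one_le_two.trans (hrev y hy)
    rw [List.reverse_reverse, h, qDeg_reverse, rNum_reverse] at h2
    have hs : sNum L.reverse = sNum L := by linarith
    rwa [hs, ← sq] at hmul
  · intro h
    obtain ⟨h0, h1⟩ := sNum_nonneg_and_lt_rNum L hL2
    obtain ⟨h0', h1'⟩ := sNum_nonneg_and_lt_rNum L.reverse hrev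
    rw [rNum_reverse] at h1'
    have hmod : sNum L.reverse ≡ sNum L [ZMOD rNum L] := by
      calc sNum L.reverse = 1 * sNum L.reverse := (one_mul _).symm
        _ ≡ sNum L ^ 2 * sNum L.reverse [ZMOD rNum L] := h.symm.mul_right _
        _ = sNum L * (sNum L * sNum L.reverse) := by ring
        _ ≡ sNum L * 1 [ZMOD rNum L] := hmul.mul_left _
        _ = sNum L := mul_one _
    have hs : sNum L.reverse = sNum L := by
      rwa [Int.ModEq, Int.emod_eq_of_lt h0' h1', Int.emod_eq_of_lt h0 h1] at hmod
    rw [eq_of_rNum_eq_of_sNum_eq L.reverse L hrev hL2 (rNum_reverse L) hs]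
end
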